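/- arXiv:2510.16827 — 2 statements merged into one kernel-verified Lean document; each statement's English description precedes it below -/
import Mathlib

section
/- Let (x^k)_{k≥0} ⊆ ℝ^n, Λ^k = (ν^k, λ^k, μ^k) ∈ ℝ^n × ℝ^m × ℝ^n, and ρ_k > 0 be sequences such that ρ_k → ∞ as k → ∞, the quotients (‖ν^k‖² + ‖λ^k‖² + ‖μ^k‖²)/ρ_k are bounded, and there exists a constant C ∈ ℝ with 𝕃_{ρ_k}(x^{k+1}, ν^k, λ^k, μ^k) ≤ C for all k. Then every accumulation point x* of the sequence (x^{k+1})_{k≥0} is feasible for the nonconvex composite problem, i.e. c(x*) ∈ Q and x* ∈ K. -/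
open Filter

/-- The Moreau envelope `e_ρ h (z) = inf_u ( h u + (ρ/2)‖u − z‖² )`, in the extended reals. -/
noncomputable def MoreauEnv {X : Type*} [NormedAddCommGroup X]
    (h : X → EReal) (ρ : ℝ) (z : X) : EReal :=
  ⨅ u : X, (h u + (((ρ / 2) * ‖u - z‖ ^ 2 : ℝ) : EReal))

/-- The augmented Lagrangian of the nonconvex composite problem
`min { f x + h x : c x ∈ Q, x ∈ K }`. -/
noncomputable def ALnc {n m : ℕ}
    (f : EuclideanSpace ℝ (Fin n) → ℝ) (h : EuclideanSpace ℝ (Fin n) → EReal)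
    (c : EuclideanSpace ℝ (Fin n) → EuclideanSpace ℝ (Fin m))
    (Q : Set (EuclideanSpace ℝ (Fin m))) (K : Set (EuclideanSpace ℝ (Fin n)))
    (ρ : ℝ) (x ν : EuclideanSpace ℝ (Fin n)) (lam : EuclideanSpace ℝ (Fin m))
    (μ : EuclideanSpace ℝ (Fin n)) : EReal :=
  ((f x : ℝ) : EReal) + MoreauEnv h ρ (x + ρ⁻¹ • ν)
    + (((ρ / 2) * (Metric.infDist (c x + ρ⁻¹ • lam) Q) ^ 2 : ℝ) : EReal)
    + (((ρ / 2) * (Metric.infDist (x + ρ⁻¹ • μ) K) ^ 2 : ℝ) : EReal)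
    - (((1 / (2 * ρ)) * (‖ν‖ ^ 2 + ‖lam‖ ^ 2 + ‖μ‖ ^ 2) : ℝ) : EReal)

open scoped Topology

theorem tendsto_sq_zero_iff {u : ℕ → ℝ} :
    Tendsto (fun k => u k ^ 2) atTop (𝓝 0) ↔ Tendsto u atTop (𝓝 0) := by
  refine ⟨fun hu => ?_, fun hu => by simpa using hu.pow 2⟩
  rw [tendsto_zero_iff_norm_tendsto_zero]
  simpa [Real.sqrt_sq_eq_abs] using hu.sqrt

theorem ALnc_lower_bound {n m : ℕ}
    (f : EuclideanSpace ℝ (Fin n) → ℝ) (h : EuclideanSpace ℝ (Fin n) → EReal)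
    (c : EuclideanSpace ℝ (Fin n) → EuclideanSpace ℝ (Fin m))
    (Q : Set (EuclideanSpace ℝ (Fin m))) (K : Set (EuclideanSpace ℝ (Fin n)))
    {ρ b : ℝ} (hρ : 0 ≤ ρ) (hb : ∀ x, (b : EReal) ≤ h x)
    (x ν : EuclideanSpace ℝ (Fin n)) (lam : EuclideanSpace ℝ (Fin m))
    (μ : EuclideanSpace ℝ (Fin n)) :
    ((f x + b + (ρ / 2) * (Metric.infDist (c x + ρ⁻¹ • lam) Q) ^ 2
      + (ρ / 2) * (Metric.infDist (x + ρ⁻¹ • μ) K) ^ 2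
      - (1 / (2 * ρ)) * (‖ν‖ ^ 2 + ‖lam‖ ^ 2 + ‖μ‖ ^ 2) : ℝ) : EReal)
      ≤ ALnc f h c Q K ρ x ν lam μ := by
  have hM : (b : EReal) ≤ MoreauEnv h ρ (x + ρ⁻¹ • ν) := by
    refine le_iInf fun u => (hb u).trans ?_
    refine le_add_of_nonneg_right ?_
    exact_mod_cast (by positivity : (0 : ℝ) ≤ ρ / 2 * ‖u - (x + ρ⁻¹ • ν)‖ ^ 2)
  rw [ALnc, EReal.coe_sub, EReal.coe_add, EReal.coe_add, EReal.coe_add]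
  exact EReal.sub_le_sub (add_le_add_left (add_le_add_left (add_le_add_right hM _) _) _) le_rfl

theorem IsClosed.mem_of_tendsto_of_penalty_bounded {E : Type*} [NormedAddCommGroup E]
    [NormedSpace ℝ E] {S : Set E} (hS : IsClosed S) (hne : S.Nonempty)
    {y v : ℕ → E} {ρ B : ℕ → ℝ} {a : E} {L M : ℝ} (hρ : ∀ k, 0 < ρ k)
    (hρtop : Tendsto ρ atTop atTop) (hy : Tendsto y atTop (𝓝 a))
    (hv : ∀ k, ‖v k‖ ^ 2 / ρ k ≤ M) (hB : Tendsto B atTop (𝓝 L))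
    (hd : ∀ k, ρ k / 2 * Metric.infDist (y k + (ρ k)⁻¹ • v k) S ^ 2 ≤ B k) : a ∈ S := by
  have hinv : Tendsto (fun k => (ρ k)⁻¹) atTop (𝓝 0) := hρtop.inv_tendsto_atTop
  have hshift : Tendsto (fun k => (ρ k)⁻¹ • v k) atTop (𝓝 0) := by
    rw [tendsto_zero_iff_norm_tendsto_zero, ← tendsto_sq_zero_iff]
    refine squeeze_zero (fun k => by positivity) (fun k => ?_)
      (by simpa using hinv.const_mul M)
    calc ‖(ρ k)⁻¹ • v k‖ ^ 2 = ‖v k‖ ^ 2 / ρ k * (ρ k)⁻¹ := by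
          rw [norm_smul, mul_pow, Real.norm_of_nonneg (inv_pos.2 (hρ k)).le]
          ring
      _ ≤ M * (ρ k)⁻¹ := mul_le_mul_of_nonneg_right (hv k) (inv_pos.2 (hρ k)).le
  have hdist : Tendsto (fun k => Metric.infDist (y k + (ρ k)⁻¹ • v k) S) atTop (𝓝 0) := by
    rw [← tendsto_sq_zero_iff]
    refine squeeze_zero (fun k => by positivity) (fun k => ?_)
      (by simpa using (hB.const_mul 2).mul hinv)
    have h1 := hd k
    have h2 := hρ k
    rw [← div_eq_mul_inv, le_div_iff₀ h2]
    linarith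
  have hlim := (Metric.continuous_infDist_pt S).continuousAt.tendsto.comp (hy.add hshift)
  rw [add_zero] at hlim
  exact (hS.mem_iff_infDist_zero hne).2 (tendsto_nhds_unique hlim hdist)

/-- If `ρ_k → ∞`, the quotients `(‖ν^k‖² + ‖λ^k‖² + ‖μ^k‖²)/ρ_k` are bounded, and the
augmented Lagrangian values `𝕃_{ρ_k}(x^{k+1}, Λ^k)` are bounded above, then every
accumulation point of `(x^{k+1})` is feasible for the nonconvex composite problem. -/
theorem accumulation_points_feasible {n m : ℕ}
    (Q : Set (EuclideanSpace ℝ (Fin m))) (K : Set (EuclideanSpace ℝ (Fin n)))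
    (hQne : Q.Nonempty) (hQcl : IsClosed Q) (hKne : K.Nonempty) (hKcl : IsClosed K)
    (c : EuclideanSpace ℝ (Fin n) → EuclideanSpace ℝ (Fin m)) (hc : Continuous c)
    (f : EuclideanSpace ℝ (Fin n) → ℝ) (hf : Continuous f)
    (h : EuclideanSpace ℝ (Fin n) → EReal)
    (hbot : ∀ x, h x ≠ ⊥) (hproper : ∃ x, h x ≠ ⊤)
    (hlsc : LowerSemicontinuous h)
    (hhbdd : ∃ b : ℝ, ∀ x, ((b : ℝ) : EReal) ≤ h x)
    (xs ν μs : ℕ → EuclideanSpace ℝ (Fin n)) (lam : ℕ → EuclideanSpace ℝ (Fin m))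
    (ρ : ℕ → ℝ) (hρpos : ∀ k, 0 < ρ k)
    (hρtop : Tendsto ρ atTop atTop)
    (hquot : ∃ M : ℝ, ∀ k, (‖ν k‖ ^ 2 + ‖lam k‖ ^ 2 + ‖μs k‖ ^ 2) / ρ k ≤ M)
    (hbddAL : ∃ C : ℝ, ∀ k,
      ALnc f h c Q K (ρ k) (xs (k + 1)) (ν k) (lam k) (μs k) ≤ ((C : ℝ) : EReal)) :
    ∀ xstar : EuclideanSpace ℝ (Fin n),
      MapClusterPt xstar atTop (fun k => xs (k + 1)) → c xstar ∈ Q ∧ xstar ∈ K := by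
  obtain ⟨b, hb⟩ := hhbdd
  obtain ⟨M, hM⟩ := hquot
  obtain ⟨C, hC⟩ := hbddAL
  intro a ha
  obtain ⟨φ, hφ, hlim⟩ := ha.tendsto_subseq
  have hbound : ∀ k,
      ρ k / 2 * Metric.infDist (c (xs (k + 1)) + (ρ k)⁻¹ • lam k) Q ^ 2
        + ρ k / 2 * Metric.infDist (xs (k + 1) + (ρ k)⁻¹ • μs k) K ^ 2
        ≤ C - b + M / 2 - f (xs (k + 1)) := by
    intro k
    have h1 := EReal.coe_le_coe_iff.1
      ((ALnc_lower_bound f h c Q K (hρpos k).le hb (xs (k + 1)) (ν k) (lam k) (μs k)).trans (hC k))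
    have h2 : 1 / (2 * ρ k) * (‖ν k‖ ^ 2 + ‖lam k‖ ^ 2 + ‖μs k‖ ^ 2)
        = (‖ν k‖ ^ 2 + ‖lam k‖ ^ 2 + ‖μs k‖ ^ 2) / ρ k / 2 := by
      have := (hρpos k).ne'
      field_simp
    linarith [hM k]
  have hB := ((hf.tendsto a).comp hlim).const_sub (C - b + M / 2)
  have hρφ := hρtop.comp hφ.tendsto_atTop
  constructor
  · refine hQcl.mem_of_tendsto_of_penalty_bounded hQne (v := lam ∘ φ) (M := M)
      (fun k => hρpos (φ k)) hρφ ((hc.tendsto a).comp hlim) (fun k => ?_) hB (fun k => ?_)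
    · refine le_trans ?_ (hM (φ k))
      have := (hρpos (φ k)).le
      dsimp only [Function.comp_apply]
      gcongr
      linarith [sq_nonneg ‖ν (φ k)‖, sq_nonneg ‖μs (φ k)‖]
    · have := (hρpos (φ k)).le
      refine le_trans (le_add_of_nonneg_right ?_) (hbound (φ k))
      positivity
  · refine hKcl.mem_of_tendsto_of_penalty_bounded hKne (v := μs ∘ φ) (M := M)
      (fun k => hρpos (φ k)) hρφ hlim (fun k => ?_) hB (fun k => ?_)
    · refine le_trans ?_ (hM (φ k))
      have := (hρpos (φ k)).le
      dsimp only [Function.comp_apply]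
      gcongr
      linarith [sq_nonneg ‖ν (φ k)‖, sq_nonneg ‖lam (φ k)‖]
    · have := (hρpos (φ k)).le
      refine le_trans (le_add_of_nonneg_left ?_) (hbound (φ k))
      positivity
end

section
/- Assume the objective f + h is bounded from below on ℝ^n (inf_x (f(x) + h(x)) > −∞), and there exists ρ̄ > 0 such that for every ρ ≥ ρ̄ the quadratically penalized function Φ_ρ(x) = 𝕃_ρ(x,0,0,0) = f(x) + e_ρh(x) + (ρ/2) dist(c(x),Q)² + (ρ/2) dist(x,K)² is lower semicontinuous and level-bounded (every sublevel set {x : Φ_ρ(x) ≤ α} is bounded). Then strong duality holds for the nonconvex composite problem with the penalty parameter treated as a dual variable: sup over ν, μ ∈ ℝ^n, λ ∈ ℝ^m, ρ > 0 of inf_{x∈ℝ^n} 𝕃_ρ(x,ν,λ,μ) equals inf_{x∈ℝ^n} of sup over ν, μ ∈ ℝ^n, λ ∈ ℝ^m, ρ > 0 of 𝕃_ρ(x,ν,λ,μ), in the extended reals. -/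
theorem MoreauEnv_mono {X : Type*} [NormedAddCommGroup X] (h : X → EReal) (z : X)
    {ρ ρ' : ℝ} (hρ : ρ ≤ ρ') : MoreauEnv h ρ z ≤ MoreauEnv h ρ' z := by
  refine iInf_mono fun u => add_le_add le_rfl ?_
  exact EReal.coe_le_coe_iff.2 (by gcongr)

theorem le_MoreauEnv {X : Type*} [NormedAddCommGroup X] {h : X → EReal} {b : EReal}
    (hb : ∀ x, b ≤ h x) {ρ : ℝ} (hρ : 0 ≤ ρ) (z : X) : b ≤ MoreauEnv h ρ z := by
  refine le_iInf fun u => (hb u).trans (le_add_of_nonneg_right ?_)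
  exact_mod_cast (by positivity : 0 ≤ ρ / 2 * ‖u - z‖ ^ 2)

/-- A lower semicontinuous function bounded below is dominated by any common upper bound of its
Moreau envelopes along parameters tending to infinity. -/
theorem le_of_forall_MoreauEnv_le {X : Type*} [NormedAddCommGroup X] {h : X → EReal}
    (hlsc : LowerSemicontinuous h) {b : ℝ} (hb : ∀ x, (b : EReal) ≤ h x) {x : X} {s : EReal}
    {ρ : ℕ → ℝ} (hρ : Filter.Tendsto ρ Filter.atTop Filter.atTop)
    (hs : ∀ k, MoreauEnv h (ρ k) x ≤ s) : h x ≤ s := by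
  by_contra! hlt
  obtain ⟨t, hst, hth⟩ := EReal.lt_iff_exists_real_btwn.1 hlt
  obtain ⟨δ, hδ, hball⟩ := Metric.eventually_nhds_iff.1 (hlsc x t hth)
  obtain ⟨k, hk, hk0⟩ := ((hρ.eventually_ge_atTop (2 * (t - b) / δ ^ 2)).and
    (hρ.eventually_ge_atTop 0)).exists
  refine (hs k).not_gt (hst.trans_le (le_iInf fun u => ?_))
  by_cases hu : dist u x < δ
  · refine (hball hu).le.trans (le_add_of_nonneg_right ?_)
    exact_mod_cast (by positivity : 0 ≤ ρ k / 2 * ‖u - x‖ ^ 2)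
  · refine le_trans ?_ (add_le_add (hb u) le_rfl)
    rw [dist_eq_norm, not_lt] at hu
    rw [div_le_iff₀ (by positivity)] at hk
    have hsq : ρ k * δ ^ 2 ≤ ρ k * ‖u - x‖ ^ 2 := by gcongr
    exact_mod_cast (by linarith : t ≤ b + ρ k / 2 * ‖u - x‖ ^ 2)

theorem ALnc_zero_multipliers {n m : ℕ}
    (f : EuclideanSpace ℝ (Fin n) → ℝ) (h : EuclideanSpace ℝ (Fin n) → EReal)
    (c : EuclideanSpace ℝ (Fin n) → EuclideanSpace ℝ (Fin m))
    (Q : Set (EuclideanSpace ℝ (Fin m))) (K : Set (EuclideanSpace ℝ (Fin n)))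
    (ρ : ℝ) (x : EuclideanSpace ℝ (Fin n)) :
    ALnc f h c Q K ρ x 0 0 0 = (f x : EReal) + MoreauEnv h ρ x
      + ((ρ / 2 * Metric.infDist (c x) Q ^ 2 : ℝ) : EReal)
      + ((ρ / 2 * Metric.infDist x K ^ 2 : ℝ) : EReal) := by
  simp only [ALnc, smul_zero, add_zero, norm_zero, ne_eq, OfNat.ofNat_ne_zero,
    not_false_eq_true, zero_pow, mul_zero, EReal.coe_zero, sub_zero]

theorem ALnc_zero_multipliers_mono {n m : ℕ}
    (f : EuclideanSpace ℝ (Fin n) → ℝ) (h : EuclideanSpace ℝ (Fin n) → EReal)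
    (c : EuclideanSpace ℝ (Fin n) → EuclideanSpace ℝ (Fin m))
    (Q : Set (EuclideanSpace ℝ (Fin m))) (K : Set (EuclideanSpace ℝ (Fin n)))
    (x : EuclideanSpace ℝ (Fin n)) {ρ ρ' : ℝ} (hρ : ρ ≤ ρ') :
    ALnc f h c Q K ρ x 0 0 0 ≤ ALnc f h c Q K ρ' x 0 0 0 := by
  rw [ALnc_zero_multipliers, ALnc_zero_multipliers]
  refine add_le_add (add_le_add (add_le_add le_rfl (MoreauEnv_mono h x hρ)) ?_) ?_ <;>
  exact EReal.coe_le_coe_iff.2 (by gcongr)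

theorem infDist_add_inv_smul_sq_le {E : Type*} [NormedAddCommGroup E] [NormedSpace ℝ E]
    {S : Set E} {y : E} (hy : y ∈ S) {ρ : ℝ} (hρ : 0 < ρ) (w : E) :
    ρ / 2 * Metric.infDist (y + ρ⁻¹ • w) S ^ 2 ≤ 1 / (2 * ρ) * ‖w‖ ^ 2 := by
  have hd : Metric.infDist (y + ρ⁻¹ • w) S ≤ ρ⁻¹ * ‖w‖ := by
    refine (Metric.infDist_le_dist_of_mem hy).trans ?_
    rw [dist_eq_norm, add_sub_cancel_left, norm_smul, Real.norm_of_nonneg (by positivity)]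
  calc ρ / 2 * Metric.infDist (y + ρ⁻¹ • w) S ^ 2 ≤ ρ / 2 * (ρ⁻¹ * ‖w‖) ^ 2 := by
        gcongr
        exact Metric.infDist_nonneg
    _ = 1 / (2 * ρ) * ‖w‖ ^ 2 := by field_simp

theorem MoreauEnv_add_inv_smul_le {E : Type*} [NormedAddCommGroup E] [NormedSpace ℝ E]
    (h : E → EReal) (x : E) {ρ : ℝ} (hρ : 0 < ρ) (w : E) :
    MoreauEnv h ρ (x + ρ⁻¹ • w) ≤ h x + ((1 / (2 * ρ) * ‖w‖ ^ 2 : ℝ) : EReal) := by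
  refine (iInf_le _ x).trans_eq ?_
  congr 2
  rw [sub_add_cancel_left, norm_neg, norm_smul, Real.norm_of_nonneg (by positivity)]
  field_simp

/-- At a feasible point the augmented Lagrangian never exceeds the objective. -/
theorem ALnc_le_of_feasible {n m : ℕ}
    (f : EuclideanSpace ℝ (Fin n) → ℝ) (h : EuclideanSpace ℝ (Fin n) → EReal)
    (c : EuclideanSpace ℝ (Fin n) → EuclideanSpace ℝ (Fin m))
    {Q : Set (EuclideanSpace ℝ (Fin m))} {K : Set (EuclideanSpace ℝ (Fin n))}
    {x : EuclideanSpace ℝ (Fin n)} (hQ : c x ∈ Q) (hK : x ∈ K) {ρ : ℝ} (hρ : 0 < ρ)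
    (ν : EuclideanSpace ℝ (Fin n)) (lam : EuclideanSpace ℝ (Fin m))
    (μ : EuclideanSpace ℝ (Fin n)) :
    ALnc f h c Q K ρ x ν lam μ ≤ (f x : EReal) + h x := by
  refine EReal.sub_le_of_le_add ?_
  refine (add_le_add (add_le_add (add_le_add le_rfl (MoreauEnv_add_inv_smul_le h x hρ ν))
    (EReal.coe_le_coe_iff.2 (infDist_add_inv_smul_sq_le hQ hρ lam)))
    (EReal.coe_le_coe_iff.2 (infDist_add_inv_smul_sq_le hK hρ μ))).trans_eq ?_
  rw [mul_add, mul_add, EReal.coe_add, EReal.coe_add]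
  simp only [add_assoc]

/-- If the quadratic penalties at `x` stay bounded as the parameter tends to infinity, then `x` is
feasible and the bound applies to the objective at `x`. -/
theorem feasible_and_le_of_forall_ALnc_le {n m : ℕ}
    {f : EuclideanSpace ℝ (Fin n) → ℝ} {h : EuclideanSpace ℝ (Fin n) → EReal}
    {c : EuclideanSpace ℝ (Fin n) → EuclideanSpace ℝ (Fin m)}
    {Q : Set (EuclideanSpace ℝ (Fin m))} {K : Set (EuclideanSpace ℝ (Fin n))}
    (hQne : Q.Nonempty) (hQcl : IsClosed Q) (hKne : K.Nonempty) (hKcl : IsClosed K)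
    (hlsc : LowerSemicontinuous h) {b : ℝ} (hb : ∀ x, (b : EReal) ≤ h x)
    {x : EuclideanSpace ℝ (Fin n)} {r : ℝ} {ρ : ℕ → ℝ} (hpos : ∀ k, 0 < ρ k)
    (hρ : Filter.Tendsto ρ Filter.atTop Filter.atTop)
    (hr : ∀ k, ALnc f h c Q K (ρ k) x 0 0 0 ≤ (r : EReal)) :
    c x ∈ Q ∧ x ∈ K ∧ (f x : EReal) + h x ≤ (r : EReal) := by
  have key : ∀ k, ρ k / 2 * (Metric.infDist (c x) Q ^ 2 + Metric.infDist x K ^ 2) ≤ r - f x - b ∧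
      MoreauEnv h (ρ k) x ≤ ((r - f x : ℝ) : EReal) := by
    intro k
    have hk := hr k
    rw [ALnc_zero_multipliers] at hk
    have hE := le_MoreauEnv hb (hpos k).le x
    have hkp := hpos k
    generalize MoreauEnv h (ρ k) x = e at hk hE ⊢
    induction e with
    | bot => simp at hE
    | top =>
      rw [EReal.coe_add_top, EReal.top_add_coe, EReal.top_add_coe] at hk
      exact absurd hk (EReal.coe_lt_top r).not_ge
    | coe e =>
      norm_cast at hk hE ⊢
      have h1 : 0 ≤ ρ k / 2 * Metric.infDist (c x) Q ^ 2 := by positivity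
      have h2 : 0 ≤ ρ k / 2 * Metric.infDist x K ^ 2 := by positivity
      constructor <;> linarith
  have hzero : Metric.infDist (c x) Q ^ 2 + Metric.infDist x K ^ 2 = 0 := by
    by_contra hne
    have hD : 0 < Metric.infDist (c x) Q ^ 2 + Metric.infDist x K ^ 2 :=
      lt_of_le_of_ne (by positivity) (Ne.symm hne)
    obtain ⟨k, hk⟩ := (((hρ.atTop_div_const two_pos).atTop_mul_const hD).eventually_gt_atTop
      (r - f x - b)).exists
    exact (key k).1.not_gt hk
  have hQ0 : Metric.infDist (c x) Q = 0 := by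
    refine (pow_eq_zero_iff two_ne_zero).1 ?_
    linarith [sq_nonneg (Metric.infDist (c x) Q), sq_nonneg (Metric.infDist x K)]
  have hK0 : Metric.infDist x K = 0 := by
    refine (pow_eq_zero_iff two_ne_zero).1 ?_
    linarith [sq_nonneg (Metric.infDist (c x) Q), sq_nonneg (Metric.infDist x K)]
  refine ⟨(hQcl.mem_iff_infDist_zero hQne).2 hQ0, (hKcl.mem_iff_infDist_zero hKne).2 hK0, ?_⟩
  refine (add_le_add le_rfl (le_of_forall_MoreauEnv_le hlsc hb hρ fun k => (key k).2)).trans_eq ?_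
  norm_cast
  ring

/-- Strong duality for the nonconvex composite problem with the penalty parameter treated
as a dual variable: if `f + h` is bounded below and the quadratic penalty
`Φ_ρ = 𝕃_ρ(·,0,0,0)` is lower semicontinuous and level-bounded for all large `ρ`, then
`sup_{ν,λ,μ,ρ>0} inf_x 𝕃_ρ = inf_x sup_{ν,λ,μ,ρ>0} 𝕃_ρ` in the extended reals. -/
theorem ALnc_strong_duality {n m : ℕ}
    (Q : Set (EuclideanSpace ℝ (Fin m))) (K : Set (EuclideanSpace ℝ (Fin n)))
    (hQne : Q.Nonempty) (hQcl : IsClosed Q) (hKne : K.Nonempty) (hKcl : IsClosed K)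
    (c : EuclideanSpace ℝ (Fin n) → EuclideanSpace ℝ (Fin m)) (hc : Continuous c)
    (f : EuclideanSpace ℝ (Fin n) → ℝ) (hf : Continuous f)
    (h : EuclideanSpace ℝ (Fin n) → EReal)
    (hbot : ∀ x, h x ≠ ⊥) (hproper : ∃ x, h x ≠ ⊤)
    (hlsc : LowerSemicontinuous h)
    (hhbdd : ∃ b : ℝ, ∀ x, ((b : ℝ) : EReal) ≤ h x)
    (hobjbdd : ∃ b : ℝ, ∀ x, ((b : ℝ) : EReal) ≤ ((f x : ℝ) : EReal) + h x)
    (hpen : ∃ ρbar : ℝ, 0 < ρbar ∧ ∀ ρ : ℝ, ρbar ≤ ρ →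
      LowerSemicontinuous (fun x => ALnc f h c Q K ρ x 0 0 0) ∧
      ∀ r : ℝ, Bornology.IsBounded
        {x : EuclideanSpace ℝ (Fin n) | ALnc f h c Q K ρ x 0 0 0 ≤ ((r : ℝ) : EReal)}) :
    (⨆ (ν : EuclideanSpace ℝ (Fin n)) (μ : EuclideanSpace ℝ (Fin n))
        (lam : EuclideanSpace ℝ (Fin m)) (ρ : ℝ) (_ : 0 < ρ),
        ⨅ x : EuclideanSpace ℝ (Fin n), ALnc f h c Q K ρ x ν lam μ)
      = ⨅ x : EuclideanSpace ℝ (Fin n),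
          ⨆ (ν : EuclideanSpace ℝ (Fin n)) (μ : EuclideanSpace ℝ (Fin n))
            (lam : EuclideanSpace ℝ (Fin m)) (ρ : ℝ) (_ : 0 < ρ),
            ALnc f h c Q K ρ x ν lam μ := by
  apply le_antisymm
  · refine le_iInf fun x => ?_
    gcongr
    exact iInf_le _ x
  · obtain ⟨b, hb⟩ := hhbdd
    obtain ⟨ρbar, hρbar, hpen⟩ := hpen
    refine EReal.le_of_forall_lt_iff_le.1 fun r hr => ?_
    have hge : ∀ k : ℕ, ρbar ≤ ρbar + k := fun k => by simp
    have hpos : ∀ k : ℕ, 0 < ρbar + k := fun k => hρbar.trans_le (hge k)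
    have hne : ∀ k : ℕ, {x | ALnc f h c Q K (ρbar + k) x 0 0 0 ≤ (r : EReal)}.Nonempty := by
      intro k
      have hlt : (⨅ x, ALnc f h c Q K (ρbar + k) x 0 0 0) < (r : EReal) := by
        refine lt_of_le_of_lt ?_ hr
        exact le_iSup_of_le 0 <| le_iSup_of_le 0 <| le_iSup_of_le 0 <|
          le_iSup_of_le (ρbar + k) <| le_iSup_of_le (hpos k) le_rfl
      obtain ⟨x, hx⟩ := iInf_lt_iff.1 hlt
      exact ⟨x, hx.le⟩
    have hcl : ∀ k : ℕ, IsClosed {x | ALnc f h c Q K (ρbar + k) x 0 0 0 ≤ (r : EReal)} :=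
      fun k => (hpen _ (hge k)).1.isClosed_preimage _
    obtain ⟨x, hx⟩ := IsCompact.nonempty_iInter_of_sequence_nonempty_isCompact_isClosed
      (fun k : ℕ => {x | ALnc f h c Q K (ρbar + k) x 0 0 0 ≤ (r : EReal)})
      (fun k x hx => (ALnc_zero_multipliers_mono f h c Q K x (by simp)).trans hx) hne
      (Metric.isCompact_of_isClosed_isBounded (hcl 0) ((hpen _ (hge 0)).2 r)) hcl
    obtain ⟨hQ, hK, hle⟩ := feasible_and_le_of_forall_ALnc_le hQne hQcl hKne hKcl hlsc hb hpos
      (Filter.tendsto_atTop_add_const_left _ _ tendsto_natCast_atTop_atTop)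
      (fun k => Set.mem_iInter.1 hx k)
    refine (iInf_le _ x).trans (le_trans ?_ hle)
    exact iSup_le fun ν => iSup_le fun μ => iSup_le fun lam => iSup_le fun ρ => iSup_le fun hρ =>
      ALnc_le_of_feasible f h c hQ hK hρ ν lam μ
end
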